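/- Let G be the 11 × 11 real symmetric matrix with all diagonal entries equal to 1 and off-diagonal entries (symmetrically extended) G₁₂ = −1, G₁₃ = −2√14/7, G₂₄ = −2√14/7, G₃₅ = −1/2, G₄,₁₁ = −1/2, and the seven entries G₅₆ = G₆₇ = G₇,₁₁ = G₁₀,₁₁ = G₉,₁₀ = G₈₉ = G₅₈ = −1/2 (so indices 5,6,7,11,10,9,8 form a 7-cycle), with all other off-diagonal entries 0. Then G has exactly 8 positive eigenvalues (with multiplicity), exactly 1 negative eigenvalue, and exactly 2 zero eigenvalues; equivalently G has rank 9 and signature (8,1). -/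

import Mathlib

open Real

noncomputable def G15 : Matrix (Fin 11) (Fin 11) ℝ :=
  !![1, -1, -(2 * Real.sqrt 14 / 7), 0, 0, 0, 0, 0, 0, 0, 0;
     -1, 1, 0, -(2 * Real.sqrt 14 / 7), 0, 0, 0, 0, 0, 0, 0;
     -(2 * Real.sqrt 14 / 7), 0, 1, 0, -(1/2), 0, 0, 0, 0, 0, 0;
     0, -(2 * Real.sqrt 14 / 7), 0, 1, 0, 0, 0, 0, 0, 0, -(1/2);
     0, 0, -(1/2), 0, 1, -(1/2), 0, -(1/2), 0, 0, 0;
     0, 0, 0, 0, -(1/2), 1, -(1/2), 0, 0, 0, 0;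
     0, 0, 0, 0, 0, -(1/2), 1, 0, 0, 0, -(1/2);
     0, 0, 0, 0, -(1/2), 0, 0, 1, -(1/2), 0, 0;
     0, 0, 0, 0, 0, 0, 0, -(1/2), 1, -(1/2), 0;
     0, 0, 0, 0, 0, 0, 0, 0, -(1/2), 1, -(1/2);
     0, 0, 0, -(1/2), 0, 0, -(1/2), 0, 0, -(1/2), 1]

open scoped Matrix

theorem Matrix.toQuadraticForm'_eq_dotProduct {n R : Type*} [Fintype n] [DecidableEq n]
    [CommRing R] (A : Matrix n n R) (x : n → R) : A.toQuadraticForm' x = x ⬝ᵥ A *ᵥ x := by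
  simp [Matrix.toQuadraticForm', Matrix.toLinearMap₂'_apply']

open QuadraticMap in
theorem Matrix.IsHermitian.equivalent_weightedSumSquares_eigenvalues {n : Type*} [Fintype n]
    [DecidableEq n] {A : Matrix n n ℝ} (hA : A.IsHermitian) :
    Equivalent A.toQuadraticForm' (weightedSumSquares ℝ hA.eigenvalues) := by
  let U : Matrix n n ℝ := hA.eigenvectorUnitary
  have hU : U * Uᵀ = 1 := by
    simpa [U, Matrix.star_eq_conjTranspose] using Unitary.coe_mul_star_self hA.eigenvectorUnitary
  have hinj : Function.Injective Uᵀ.mulVecLin := fun x y hxy => by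
    simpa only [Matrix.mulVecLin_apply, Matrix.mulVec_mulVec, hU, Matrix.one_mulVec] using
      congrArg (U *ᵥ ·) hxy
  refine ⟨⟨LinearEquiv.ofInjectiveEndo _ hinj, fun x => ?_⟩⟩
  have hspec : A = U * Matrix.diagonal hA.eigenvalues * Uᵀ := by
    simpa [U, Unitary.conjStarAlgAut_apply, Matrix.star_eq_conjTranspose, Function.comp_def]
      using hA.spectral_theorem
  have hx : A *ᵥ x = U *ᵥ (Matrix.diagonal hA.eigenvalues *ᵥ (Uᵀ *ᵥ x)) := by
    conv_lhs => rw [hspec]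
    simp [Matrix.mulVec_mulVec, Matrix.mul_assoc]
  rw [Matrix.toQuadraticForm'_eq_dotProduct, hx, Matrix.dotProduct_mulVec,
    ← Matrix.mulVec_transpose]
  simp only [weightedSumSquares_apply, dotProduct, Matrix.mulVec_diagonal, smul_eq_mul]
  refine Finset.sum_congr rfl fun i _ => ?_
  change _ * ((Uᵀ *ᵥ x) i * (Uᵀ *ᵥ x) i) = _
  ring

open QuadraticMap in
/-- **Sylvester's law of inertia** for the eigenvalues of a real symmetric matrix. -/
theorem Matrix.IsHermitian.card_eigenvalues_of_equivalent {n ι : Type*} [Fintype n]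
    [DecidableEq n] [Fintype ι] {A : Matrix n n ℝ} (hA : A.IsHermitian) {w : ι → ℝ}
    (h : Equivalent A.toQuadraticForm' (weightedSumSquares ℝ w)) :
    (Finset.univ.filter fun j => 0 < hA.eigenvalues j).card =
        (Finset.univ.filter fun i => 0 < w i).card ∧
      (Finset.univ.filter fun j => hA.eigenvalues j < 0).card =
        (Finset.univ.filter fun i => w i < 0).card := by
  have he := hA.equivalent_weightedSumSquares_eigenvalues
  constructor
  · simpa [Set.ncard_eq_toFinset_card'] using
      (QuadraticForm.sigPos_of_equiv_weightedSumSquares he).symm.trans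
        (QuadraticForm.sigPos_of_equiv_weightedSumSquares h)
  · simpa [Set.ncard_eq_toFinset_card'] using
      (QuadraticForm.sigNeg_of_equiv_weightedSumSquares he).symm.trans
        (QuadraticForm.sigNeg_of_equiv_weightedSumSquares h)

/-- The coefficients of the squares when the quadratic form of `G15` is diagonalized. -/
noncomputable def G15weights : Fin 11 → ℝ :=
  ![1, 1, 3/4, 3/4, 2/3, 1, 1, 1/24, -2, 0, 0]

/-- The change of coordinates that completes the squares in the quadratic form of `G15`. -/
noncomputable def G15coords : (Fin 11 → ℝ) →ₗ[ℝ] (Fin 11 → ℝ) :=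
  let c : ℝ := 2 * Real.sqrt 14 / 7
  Matrix.mulVecLin
    !![0, 0, 0, 0, -(1/2), 1, -(1/2), 0, 0, 0, 0;
       0, 0, 0, 0, -(1/2), 0, 0, 1, -(1/2), 0, 0;
       0, 0, 0, 0, -(1/3), 0, 1, 0, 0, 0, -(2/3);
       0, 0, 0, 0, -(1/3), 0, 0, 0, 1, -(2/3), 0;
       0, 0, 0, 0, -(1/4), 0, 0, 0, 0, 1, -(3/4);
       -c, 0, 1, 0, -(1/2), 0, 0, 0, 0, 0, 0;
       0, -c, 0, 1, 0, 0, 0, 0, 0, 0, -(1/2);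
       -(12 * c), 0, 0, 0, 1, 0, 0, 0, 0, 0, -7;
       7 * c / 4, c / 4, 0, 0, 0, 0, 0, 0, 0, 0, 1;
       1, 0, 0, 0, 0, 0, 0, 0, 0, 0, 0;
       0, 1, 0, 0, 0, 0, 0, 0, 0, 0, 0]

theorem G15coords_apply (x : Fin 11 → ℝ) :
    G15coords x =
      ![x 5 - x 4 / 2 - x 6 / 2, x 7 - x 4 / 2 - x 8 / 2, x 6 - x 4 / 3 - 2 / 3 * x 10,
        x 8 - x 4 / 3 - 2 / 3 * x 9, x 9 - x 4 / 4 - 3 / 4 * x 10,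
        x 2 - 2 * √14 / 7 * x 0 - x 4 / 2, x 3 - 2 * √14 / 7 * x 1 - x 10 / 2,
        x 4 - 12 * (2 * √14 / 7) * x 0 - 7 * x 10,
        x 10 + 7 * (2 * √14 / 7) / 4 * x 0 + 2 * √14 / 7 / 4 * x 1, x 0, x 1] := by
  ext i
  fin_cases i <;> simp [G15coords, Matrix.mulVec, dotProduct, Fin.sum_univ_succ] <;> ring

theorem G15coords_injective : Function.Injective G15coords := by
  rw [injective_iff_map_eq_zero]
  intro x hx
  rw [G15coords_apply] at hx
  have h (i : Fin 11) := congrFun hx i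
  have h0 : x 0 = 0 := by simpa using h 9
  have h1 : x 1 = 0 := by simpa using h 10
  have h10 : x 10 = 0 := by simpa [h0, h1] using h 8
  have h4 : x 4 = 0 := by simpa [h0, h10] using h 7
  have h3 : x 3 = 0 := by simpa [h1, h10] using h 6
  have h2 : x 2 = 0 := by simpa [h0, h4] using h 5
  have h9 : x 9 = 0 := by simpa [h4, h10] using h 4
  have h8 : x 8 = 0 := by simpa [h4, h9] using h 3
  have h6 : x 6 = 0 := by simpa [h4, h10] using h 2
  have h7 : x 7 = 0 := by simpa [h4, h8] using h 1
  have h5 : x 5 = 0 := by simpa [h4, h6] using h 0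
  ext i
  fin_cases i <;> assumption

open QuadraticMap in
theorem G15_equivalent_weightedSumSquares :
    Equivalent G15.toQuadraticForm' (weightedSumSquares ℝ G15weights) := by
  refine ⟨⟨LinearEquiv.ofInjectiveEndo _ G15coords_injective, fun x => ?_⟩⟩
  have hs : √14 ^ 2 = (14 : ℝ) := Real.sq_sqrt (by norm_num)
  rw [Matrix.toQuadraticForm'_eq_dotProduct]
  simp [G15coords_apply, G15weights, G15, Matrix.mulVec, dotProduct, Fin.sum_univ_succ]
  ring_nf
  rw [hs]
  ring

theorem stmt_15 (hG : G15.IsHermitian) :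
    (Finset.univ.filter fun j => 0 < hG.eigenvalues j).card = 8 ∧
    (Finset.univ.filter fun j => hG.eigenvalues j < 0).card = 1 ∧
    (Finset.univ.filter fun j => hG.eigenvalues j = 0).card = 2 ∧
    G15.rank = 9 := by
  obtain ⟨hpos, hneg⟩ := hG.card_eigenvalues_of_equivalent G15_equivalent_weightedSumSquares
  have hpos8 : (Finset.univ.filter fun i => 0 < G15weights i).card = 8 := by
    have : (Finset.univ.filter fun i => 0 < G15weights i) = {0, 1, 2, 3, 4, 5, 6, 7} := by
      ext i
      fin_cases i <;> norm_num [G15weights] <;> decide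
    rw [this]
    rfl
  have hneg1 : (Finset.univ.filter fun i => G15weights i < 0).card = 1 := by
    have : (Finset.univ.filter fun i => G15weights i < 0) = {8} := by
      ext i
      fin_cases i <;> norm_num [G15weights] <;> decide
    rw [this]
    rfl
  rw [hpos8] at hpos
  rw [hneg1] at hneg
  have hne : (Finset.univ.filter fun j => hG.eigenvalues j ≠ 0).card = 9 := by
    have hsplit : (Finset.univ.filter fun j => hG.eigenvalues j ≠ 0) =
        (Finset.univ.filter fun j => 0 < hG.eigenvalues j) ∪
          (Finset.univ.filter fun j => hG.eigenvalues j < 0) := by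
      ext j
      simpa only [Finset.mem_union, Finset.mem_filter, Finset.mem_univ, true_and] using
        lt_or_lt_iff_ne.symm.trans or_comm
    rw [hsplit, Finset.card_union_of_disjoint, hpos, hneg]
    exact Finset.disjoint_filter.2 fun j _ h => h.not_gt
  have hall := Finset.card_filter_add_card_filter_not (s := Finset.univ)
    (fun j => hG.eigenvalues j = 0)
  rw [Finset.card_univ, Fintype.card_fin] at hall
  refine ⟨hpos, hneg, by lia, ?_⟩
  rw [hG.rank_eq_card_non_zero_eigs, Fintype.card_subtype, hne]
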